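/- arXiv:2102.00474 — 4 statements merged into one kernel-verified Lean document; each statement's English description precedes it below -/
import Mathlib

section
/- If C is a self-dual code of length n over the ring R₁ = F₂ + uF₂ (u² = 0), then the Gray image φ(C) is a self-dual binary code of length 2n; that is, φ(C) is an F₂-subspace of F₂^{2n} equal to its own Euclidean dual. -/
/-- A submodule `C ≤ R^ι` is self-dual if it equals its Euclidean dual. -/
def IsSelfDual {R : Type*} [CommRing R] {ι : Type*} [Fintype ι]
    (C : Submodule R (ι → R)) : Prop :=
  ∀ x, x ∈ C ↔ ∀ y ∈ C, ∑ i, x i * y i = 0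

/-- The Gray map `φ(ā + b̄u) = (b̄, ā + b̄)` from `R₁^n` to `F₂^{2n}`,
where `R₁ = F₂ + uF₂` is realized as the dual numbers over `ZMod 2`. -/
def grayMap {n : ℕ} (v : Fin n → DualNumber (ZMod 2)) : Fin (n + n) → ZMod 2 :=
  Fin.append (fun i => TrivSqZeroExt.snd (v i))
    (fun i => TrivSqZeroExt.fst (v i) + TrivSqZeroExt.snd (v i))

/-- The Gray map as an `F₂`-linear map. -/
def grayLinearMap (n : ℕ) :
    (Fin n → DualNumber (ZMod 2)) →ₗ[ZMod 2] (Fin (n + n) → ZMod 2) where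
  toFun := grayMap
  map_add' x y := by
    ext i
    refine Fin.addCases (fun j => ?_) (fun j => ?_) i
    · simp [grayMap]
    · simp [grayMap, -Fin.natAdd_eq_addNat, add_add_add_comm]
  map_smul' c x := by
    ext i
    refine Fin.addCases (fun j => ?_) (fun j => ?_) i
    · simp [grayMap]
    · simp [grayMap, -Fin.natAdd_eq_addNat, mul_add]

theorem grayMap_surjective {n : ℕ} : Function.Surjective (grayMap (n := n)) := by
  intro w
  refine ⟨fun i => (w (Fin.natAdd n i) - w (Fin.castAdd n i), w (Fin.castAdd n i)), ?_⟩
  ext i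
  refine Fin.addCases (fun j => ?_) (fun j => ?_) i <;>
    simp [grayMap, -Fin.natAdd_eq_addNat, TrivSqZeroExt.fst, TrivSqZeroExt.snd]

/-- The inner product of Gray images is the sum of the two coordinates of the inner product. -/
theorem sum_grayMap_mul_grayMap {n : ℕ} (x y : Fin n → DualNumber (ZMod 2)) :
    ∑ i, grayMap x i * grayMap y i =
      TrivSqZeroExt.fst (∑ i, x i * y i) + TrivSqZeroExt.snd (∑ i, x i * y i) := by
  rw [Fin.sum_univ_add, TrivSqZeroExt.fst_sum, TrivSqZeroExt.snd_sum,
    ← Finset.sum_add_distrib, ← Finset.sum_add_distrib]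
  refine Finset.sum_congr rfl fun i _ => ?_
  simp only [grayMap, Fin.append_left, Fin.append_right, TrivSqZeroExt.fst_mul,
    DualNumber.snd_mul]
  linear_combination CharTwo.add_self_eq_zero
    (TrivSqZeroExt.snd (x i) * TrivSqZeroExt.snd (y i))

/-- A vector is orthogonal to a code over `R₁` iff their Gray images are orthogonal. -/
theorem forall_sum_grayMap_mul_eq_zero_iff {n : ℕ}
    (C : Submodule (DualNumber (ZMod 2)) (Fin n → DualNumber (ZMod 2)))
    (x : Fin n → DualNumber (ZMod 2)) :
    (∀ y ∈ C, ∑ i, grayMap x i * grayMap y i = 0) ↔ ∀ y ∈ C, ∑ i, x i * y i = 0 := by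
  simp only [sum_grayMap_mul_grayMap]
  refine ⟨fun h y hy => ?_, fun h y hy => by simp [h y hy]⟩
  have hsum := h y hy
  have heps := h _ (C.smul_mem DualNumber.eps hy)
  simp only [Pi.smul_apply, smul_eq_mul, mul_left_comm _ DualNumber.eps,
    ← Finset.mul_sum] at heps
  have hfst : TrivSqZeroExt.fst (∑ i, x i * y i) = 0 := by
    simpa only [TrivSqZeroExt.fst_mul, DualNumber.snd_mul, DualNumber.fst_eps,
      DualNumber.snd_eps, zero_mul, one_mul, zero_add] using heps
  rw [hfst, zero_add] at hsum
  exact TrivSqZeroExt.ext hfst hsum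

/-- If `C` is a self-dual code of length `n` over `R₁ = F₂ + uF₂`, then the Gray image
`φ(C)` is an `F₂`-subspace of `F₂^{2n}` which is self-dual. -/
theorem gray_image_of_selfDual_is_selfDual {n : ℕ}
    (C : Submodule (DualNumber (ZMod 2)) (Fin n → DualNumber (ZMod 2)))
    (hC : IsSelfDual C) :
    ∃ D : Submodule (ZMod 2) (Fin (n + n) → ZMod 2),
      (D : Set (Fin (n + n) → ZMod 2)) = grayMap '' (C : Set (Fin n → DualNumber (ZMod 2))) ∧
      IsSelfDual D := by
  refine ⟨(C.restrictScalars (ZMod 2)).map (grayLinearMap n), rfl, fun w => ?_⟩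
  obtain ⟨x, rfl⟩ := grayMap_surjective w
  have hmem (z) : z ∈ (C.restrictScalars (ZMod 2)).map (grayLinearMap n) ↔
      ∃ y ∈ C, grayMap y = z := Iff.rfl
  simp only [hmem, forall_exists_index, and_imp, forall_apply_eq_imp_iff₂]
  rw [forall_sum_grayMap_mul_eq_zero_iff, ← hC]
  refine ⟨?_, fun hx => ⟨x, hx, rfl⟩⟩
  rintro ⟨y, hy, hyx⟩
  rw [hC, ← forall_sum_grayMap_mul_eq_zero_iff, ← hyx, forall_sum_grayMap_mul_eq_zero_iff, ← hC]
  exact hy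
end

section
/- Let C be a linear code over R₁ = F₂ + uF₂ of length n and let C' = μ(C) be its coordinatewise projection to F₂. Assume C' contains a nonzero vector. Let d be the minimum Lee weight of a nonzero codeword of C and d' the minimum Hamming weight of a nonzero codeword of C'. Then d ≤ 2d'. -/
/-- The Lee weight on `R₁ = F₂ + uF₂` (dual numbers over `ZMod 2`):
`0 ↦ 0`, `1 ↦ 1`, `u ↦ 2`, `1 + u ↦ 1`. -/
def leeWt (x : DualNumber (ZMod 2)) : ℕ :=
  if TrivSqZeroExt.fst x = 0 then (if TrivSqZeroExt.snd x = 0 then 0 else 2) else 1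

/-- The Lee weight of a vector over `R₁` is the sum of the Lee weights of its coordinates. -/
def leeWtVec {n : ℕ} (v : Fin n → DualNumber (ZMod 2)) : ℕ :=
  ∑ i, leeWt (v i)

/-- The Hamming weight of a vector: the number of nonzero coordinates. -/
def hamWt {ι : Type*} [Fintype ι] {R : Type*} [Zero R] [DecidableEq R] (v : ι → R) : ℕ :=
  (Finset.univ.filter fun i => v i ≠ 0).card

/-- The coordinatewise projection `μ(a + bu) = a` from `R₁^ι` to `F₂^ι`. -/
def muMap {ι : Type*} (v : ι → DualNumber (ZMod 2)) : ι → ZMod 2 :=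
  fun i => TrivSqZeroExt.fst (v i)

theorem fst_eps_mul (x : DualNumber (ZMod 2)) :
    TrivSqZeroExt.fst (DualNumber.eps * x) = 0 := by
  simp

theorem snd_eps_mul (x : DualNumber (ZMod 2)) :
    TrivSqZeroExt.snd (DualNumber.eps * x) = TrivSqZeroExt.fst x := by
  simp

theorem leeWt_eps_mul (x : DualNumber (ZMod 2)) :
    leeWt (DualNumber.eps * x) = if TrivSqZeroExt.fst x = 0 then 0 else 2 := by
  rw [leeWt, fst_eps_mul, snd_eps_mul, if_pos rfl]

/-- Multiplication by `u` turns a vector into one whose Lee weight is twice the Hamming weight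
of the projection. -/
theorem leeWtVec_eps_smul {n : ℕ} (v : Fin n → DualNumber (ZMod 2)) :
    leeWtVec ((DualNumber.eps : DualNumber (ZMod 2)) • v) = 2 * hamWt (muMap v) := by
  rw [leeWtVec, hamWt, Finset.card_filter, Finset.mul_sum]
  refine Finset.sum_congr rfl fun i _ => ?_
  rw [Pi.smul_apply, smul_eq_mul, leeWt_eps_mul, ite_not, mul_ite, mul_zero, mul_one, muMap]

theorem muMap_eq_zero_of_eps_smul_eq_zero {ι : Type*} {v : ι → DualNumber (ZMod 2)}
    (h : (DualNumber.eps : DualNumber (ZMod 2)) • v = 0) : muMap v = 0 := by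
  funext i
  have hi : DualNumber.eps * v i = 0 := congrFun h i
  rw [muMap, ← snd_eps_mul, hi, TrivSqZeroExt.snd_zero, Pi.zero_apply]

/-- If `C` is a linear code over `R₁ = F₂ + uF₂` of length `n` and `C' = μ(C)` contains a
nonzero vector, `d` is the minimum Lee weight of a nonzero codeword of `C` and `d'` the minimum
Hamming weight of a nonzero codeword of `C'`, then `d ≤ 2d'`. -/
theorem min_lee_le_two_mul_min_hamming {n : ℕ}
    (C : Submodule (DualNumber (ZMod 2)) (Fin n → DualNumber (ZMod 2)))
    (hne : ∃ w ∈ muMap '' (C : Set (Fin n → DualNumber (ZMod 2))), w ≠ (0 : Fin n → ZMod 2))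
    (d d' : ℕ)
    (hd : IsLeast {k | ∃ v ∈ C, v ≠ 0 ∧ leeWtVec v = k} d)
    (hd' : IsLeast {k | ∃ w ∈ muMap '' (C : Set (Fin n → DualNumber (ZMod 2))),
      w ≠ 0 ∧ hamWt w = k} d') :
    d ≤ 2 * d' := by
  obtain ⟨_, ⟨v, hv, rfl⟩, hv0, rfl⟩ := hd'.1
  exact hd.2 ⟨(DualNumber.eps : DualNumber (ZMod 2)) • v, C.smul_mem _ hv,
    mt muMap_eq_zero_of_eps_smul_eq_zero hv0, leeWtVec_eps_smul v⟩
end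

section
/- There exists a self-dual binary linear code C ⊆ F₂^{72} whose minimum nonzero Hamming weight is 12, which contains exactly 240 codewords of Hamming weight 12 and exactly 8640 codewords of Hamming weight 14 (the weight enumerator W_{72,1} with γ = 0 and β = 120). -/
namespace BitSliced

/-- The concatenation of two bit strings, each given as its length and its binary value. -/
def bitConcat (p q : ℕ × ℕ) : ℕ × ℕ :=
  (Nat.add p.1 q.1, Nat.lor p.2 (Nat.shiftLeft q.2 p.1))

/-- The number whose binary expansion consists of `n` ones. -/
def bitMask (n : ℕ) : ℕ := Nat.sub (Nat.shiftLeft 1 n) 1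

/-- Complement every bit of a bit string if `b` holds. -/
def bitFlip (b : Bool) (p : ℕ × ℕ) : ℕ × ℕ :=
  (p.1, b.rec p.2 (Nat.xor p.2 (bitMask p.1)))

/-- One step of `laneTable`: prepend a row entry `b`, given the entry `p` preceding a table. -/
def laneStep (b : Bool) : ℕ × ℕ → List (ℕ × ℕ) → List (ℕ × ℕ)
  | _, [] => []
  | p, q :: t => bitConcat q (bitFlip b p) :: laneStep b q t

/-- The `k`-th entry, `k ≤ K`, is the bit string of the parities of all sublists of length `k`. -/
def laneTable (K : ℕ) : List Bool → List (ℕ × ℕ)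
  | [] => (1, 0) :: List.replicate K (0, 0)
  | b :: bs => laneStep b (0, 0) (laneTable K bs)

/-- The lanewise parity of `s` and a list of numbers. -/
def sumBit : ℕ → List ℕ → ℕ
  | s, [] => s
  | s, [x] => Nat.xor s x
  | s, x :: y :: t => sumBit (Nat.xor (Nat.xor s x) y) t

/-- The carries of the full adders that compute `sumBit`. -/
def carries : ℕ → List ℕ → List ℕ
  | _, [] => []
  | s, [x] => [Nat.land s x]
  | s, x :: y :: t =>
    Nat.lor (Nat.land s x) (Nat.land (Nat.xor s x) y) :: carries (Nat.xor (Nat.xor s x) y) t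

/-- The binary digits, lowest first, of the lanewise number of ones in a list of numbers. -/
def laneDigits : ℕ → List ℕ → List ℕ
  | 0, _ => []
  | _ + 1, [] => []
  | f + 1, x :: t => sumBit x t :: laneDigits f (carries x t)

/-- The lanes whose value, given by a list of binary digits, equals `m`. -/
def eqFlag (ones : ℕ) : List ℕ → ℕ → ℕ
  | [], m => (Nat.beq m 0).rec 0 ones
  | d :: ds, m => Nat.land ((Nat.beq (Nat.land m 1) 1).rec (Nat.xor ones d) d)
      (eqFlag ones ds (Nat.shiftRight m 1))

/-- The number of ones among the lowest `2 ^ d` bits. -/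
def popCount : ℕ → ℕ → ℕ
  | 0, x => x
  | d + 1, x => (Nat.beq x 0).rec (Nat.add (popCount d (Nat.land x (bitMask (Nat.pow 2 d))))
      (popCount d (Nat.shiftRight x (Nat.pow 2 d)))) 0

/-- For each `m` in `ms`, the number of sums of `k` rows of weight `m`, for a binary matrix with
columns `cols`, all sums being treated in parallel as lanes of long binary numbers. -/
def weightCounts (d K k : ℕ) (cols : List (List Bool)) (ms : List ℕ) : List ℕ :=
  let ps := cols.map fun c => (laneTable K c).getD k (0, 0)
  let ones := bitMask (ps.headD (0, 0)).1
  let ds := laneDigits 6 (ps.map Prod.snd)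
  ms.map fun m => popCount d (eqFlag ones ds m)

/-- The number with given binary digits, lowest first. -/
def ofBits : List Bool → ℕ
  | [] => 0
  | b :: t => Nat.bit b (ofBits t)

/-- The bit string with given bits, lowest first. -/
def pack (l : List Bool) : ℕ × ℕ := (l.length, ofBits l)

/-- Whether a list of booleans has an odd number of true entries. -/
def parity (l : List Bool) : Bool := l.foldr xor false

/-- The parities of all sublists of length `k`. -/
def lanes (bs : List Bool) (k : ℕ) : List Bool := (bs.sublistsLen k).map parity

theorem testBit_ofBits (l : List Bool) (j : ℕ) : (ofBits l).testBit j = l.getD j false := by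
  induction l generalizing j with
  | nil => simp [ofBits]
  | cons b t ih => cases j <;> simp [ofBits, Nat.testBit_bit_succ, ih]

theorem testBit_bitMask (n j : ℕ) : (bitMask n).testBit j = decide (j < n) := by
  have : bitMask n = 2 ^ n - 1 := by
    change 1 <<< n - 1 = _
    rw [Nat.one_shiftLeft]
  rw [this, Nat.testBit_two_pow_sub_one]

theorem pack_append (l l' : List Bool) : pack (l ++ l') = bitConcat (pack l) (pack l') := by
  refine Prod.ext (by simp [pack, bitConcat]) ?_
  change ofBits (l ++ l') = ofBits l ||| ofBits l' <<< l.length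
  refine Nat.eq_of_testBit_eq fun j => ?_
  rw [Nat.testBit_or, Nat.testBit_shiftLeft, testBit_ofBits, testBit_ofBits, testBit_ofBits]
  rcases lt_or_ge j l.length with h | h
  · rw [List.getD_append _ _ _ _ h]
    simp [h.not_ge]
  · rw [List.getD_append_right _ _ _ _ h, List.getD_eq_default _ _ h]
    simp [h]

theorem pack_map_xor (b : Bool) (l : List Bool) : pack (l.map (xor b)) = bitFlip b (pack l) := by
  refine Prod.ext (by simp [pack, bitFlip]) ?_
  cases b
  · have : l.map (xor false) = l := by simp [funext Bool.false_xor]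
    rw [this]
    rfl
  · change ofBits _ = ofBits l ^^^ bitMask l.length
    refine Nat.eq_of_testBit_eq fun j => ?_
    rw [Nat.testBit_xor, testBit_ofBits, testBit_ofBits, testBit_bitMask]
    rcases lt_or_ge j l.length with h | h <;> simp [h]

theorem lanes_cons_succ (b : Bool) (bs : List Bool) (k : ℕ) :
    lanes (b :: bs) (k + 1) = lanes bs (k + 1) ++ (lanes bs k).map (xor b) := by
  simp [lanes, List.sublistsLen_succ_cons, parity, Function.comp_def]

theorem laneStep_pack (b : Bool) (bs : List Bool) (n k : ℕ) :
    laneStep b (pack (lanes bs k)) ((List.range' (k + 1) n).map (pack ∘ lanes bs)) =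
      (List.range' (k + 1) n).map (pack ∘ lanes (b :: bs)) := by
  induction n generalizing k with
  | zero => rfl
  | succ n ih =>
    simp only [List.range'_succ, List.map_cons, laneStep, Function.comp_apply] at ih ⊢
    rw [lanes_cons_succ, pack_append, pack_map_xor]
    exact congrArg _ (ih (k + 1))

theorem laneTable_eq (K : ℕ) (bs : List Bool) :
    laneTable K bs = (List.range' 0 (K + 1)).map (pack ∘ lanes bs) := by
  induction bs with
  | nil =>
    rw [List.range'_succ, List.map_cons, laneTable]
    refine congrArg₂ _ rfl (Eq.symm (List.eq_replicate_iff.2 ⟨by simp, ?_⟩))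
    simp only [List.mem_map, List.mem_range'_1]
    rintro _ ⟨k, hk, rfl⟩
    obtain ⟨k, rfl⟩ := Nat.exists_eq_succ_of_ne_zero (by omega : k ≠ 0)
    rfl
  | cons b bs ih =>
    rw [laneTable, ih, List.range'_succ, List.map_cons, List.map_cons, laneStep]
    have h := laneStep_pack b bs K 0
    refine congrArg₂ _ ?_ h
    cases b <;> simp [lanes, pack, bitConcat, bitFlip, parity, ofBits, bitMask]

theorem laneTable_getD {K k : ℕ} (hk : k ≤ K) (bs : List Bool) :
    (laneTable K bs).getD k (0, 0) = pack (lanes bs k) := by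
  rw [laneTable_eq, List.getD_eq_getElem _ _ (by simp; omega)]
  simp

/-- The number of elements of a list whose `j`-th bit is set. -/
def laneSum (j : ℕ) (xs : List ℕ) : ℕ := (xs.map fun x => (x.testBit j).toNat).sum

/-- The number whose binary digits, lowest first, are the `j`-th bits of the elements of a list. -/
def laneValue (j : ℕ) (ds : List ℕ) : ℕ := ds.foldr (fun d a => (d.testBit j).toNat + 2 * a) 0

theorem sumBit_add_carries (j s : ℕ) (xs : List ℕ) :
    ((sumBit s xs).testBit j).toNat + 2 * laneSum j (carries s xs) = laneSum j (s :: xs) := by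
  induction s, xs using sumBit.induct with
  | case1 s => simp [sumBit, carries, laneSum]
  | case2 s x =>
    change ((s ^^^ x).testBit j).toNat + 2 * laneSum j [s &&& x] = _
    simp only [laneSum, List.map_cons, List.map_nil, List.sum_cons, List.sum_nil,
      Nat.testBit_xor, Nat.testBit_and]
    cases s.testBit j <;> cases x.testBit j <;> rfl
  | case3 s x y t ih =>
    simp only [sumBit, carries]
    simp only [laneSum, List.map_cons, List.sum_cons] at ih ⊢
    change _ + 2 * (((s &&& x ||| (s ^^^ x) &&& y).testBit j).toNat + _) = _
    change _ = ((s ^^^ x ^^^ y).testBit j).toNat + _ at ih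
    simp only [Nat.testBit_xor, Nat.testBit_and, Nat.testBit_or] at ih ⊢
    revert ih
    cases s.testBit j <;> cases x.testBit j <;> cases y.testBit j <;>
      simp <;> omega

theorem length_carries (s : ℕ) (xs : List ℕ) : (carries s xs).length = (xs.length + 1) / 2 := by
  induction s, xs using carries.induct with
  | case1 s => simp [carries]
  | case2 s x => simp [carries]
  | case3 s x y t ih =>
    rw [carries, List.length_cons, ih, List.length_cons, List.length_cons]
    omega

theorem laneValue_laneDigits (j f : ℕ) (xs : List ℕ) (h : xs.length < 2 ^ f) :
    laneValue j (laneDigits f xs) = laneSum j xs := by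
  induction f generalizing xs with
  | zero =>
    obtain rfl : xs = [] := List.length_eq_zero_iff.1 (by simpa using h)
    rfl
  | succ f ih =>
    cases xs with
    | nil => rfl
    | cons x t =>
      rw [← sumBit_add_carries, ← ih _ (by
        rw [length_carries]; simp only [List.length_cons, pow_succ] at h; omega)]
      rfl

theorem testBit_eqFlag (N : ℕ) (ds : List ℕ) (m j : ℕ) :
    (eqFlag (bitMask N) ds m).testBit j = decide (j < N ∧ laneValue j ds = m) := by
  induction ds generalizing m with
  | nil =>
    cases m with
    | zero => simp [eqFlag, laneValue, testBit_bitMask]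
    | succ m =>
      change (0 : ℕ).testBit j = decide (j < N ∧ 0 = m + 1)
      simp
  | cons d ds ih =>
    have h1 : Nat.land m 1 = m % 2 := Nat.and_one_is_mod m
    have h2 : Nat.shiftRight m 1 = m / 2 := Nat.shiftRight_one m
    rw [eqFlag, h1, h2]
    change (_ &&& _ : ℕ).testBit j = _
    rw [Nat.testBit_and, ih]
    change _ = decide (j < N ∧ (d.testBit j).toNat + 2 * laneValue j ds = m)
    rcases Nat.mod_two_eq_zero_or_one m with h | h
    · rw [h]
      change ((bitMask N ^^^ d).testBit j && _) = _
      rw [Nat.testBit_xor, testBit_bitMask]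
      by_cases hj : j < N <;> cases d.testBit j <;> simp [hj] <;> omega
    · rw [h]
      change (d.testBit j && _) = _
      by_cases hj : j < N <;> cases d.testBit j <;> simp [hj] <;> omega

theorem popCount_ofBits (d : ℕ) (l : List Bool) (h : l.length ≤ 2 ^ d) :
    popCount d (ofBits l) = l.count true := by
  induction d generalizing l with
  | zero =>
    match l, h with
    | [], _ => rfl
    | [b], _ => cases b <;> rfl
  | succ d ih =>
    have hl : Nat.land (ofBits l) (bitMask (Nat.pow 2 d)) = ofBits (l.take (2 ^ d)) := by
      change ofBits l &&& bitMask (2 ^ d) = _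
      refine Nat.eq_of_testBit_eq fun j => ?_
      rw [Nat.testBit_and, testBit_ofBits, testBit_ofBits, testBit_bitMask]
      by_cases hj : j < 2 ^ d <;> simp [List.getD_eq_getElem?_getD, hj]
    have hr : Nat.shiftRight (ofBits l) (Nat.pow 2 d) = ofBits (l.drop (2 ^ d)) := by
      change ofBits l >>> 2 ^ d = _
      refine Nat.eq_of_testBit_eq fun j => ?_
      rw [Nat.testBit_shiftRight, testBit_ofBits, testBit_ofBits]
      simp [List.getD_eq_getElem?_getD]
    rw [popCount, hl, hr, ih _ (by simp), ih _ (by simp; rw [pow_succ] at h; omega)]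
    have hsum : (l.take (2 ^ d)).count true + (l.drop (2 ^ d)).count true = l.count true := by
      rw [← List.count_append, List.take_append_drop]
    by_cases h0 : ofBits l = 0
    · have : l.count true = 0 := by
        refine List.count_eq_zero.2 fun hm => ?_
        obtain ⟨j, hj, hjt⟩ := List.getElem_of_mem hm
        have := testBit_ofBits l j
        rw [List.getD_eq_getElem _ _ hj, hjt, h0] at this
        exact Bool.false_ne_true ((Nat.zero_testBit j).symm.trans this)
      rw [h0, this]
      rfl
    · have : Nat.beq (ofBits l) 0 = false := by
        rw [← Bool.not_eq_true, Nat.beq_eq]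
        exact h0
      rw [this]
      exact hsum

section Counting

variable {α β : Type*}

theorem sublistsLen_map_eq (f : α → β) (k : ℕ) (l : List α) :
    (l.map f).sublistsLen k = (l.sublistsLen k).map (List.map f) := by
  induction l generalizing k with
  | nil => cases k <;> simp
  | cons a l ih => cases k <;> simp [ih, Function.comp_def]

theorem parity_column {is : List α} {js : List β} (A : α → β → Bool) {k K : ℕ} (hk : k ≤ K) :
    (js.map fun j => is.map fun i => A i j).map (fun c => (laneTable K c).getD k (0, 0)) =
      js.map fun j => pack ((is.sublistsLen k).map fun S => parity (S.map fun i => A i j)) := by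
  rw [List.map_map]
  refine List.map_congr_left fun j _ => ?_
  rw [Function.comp_apply, laneTable_getD hk, lanes, sublistsLen_map_eq, List.map_map]
  rfl

theorem laneSum_columns (js : List β) (f : List α → β → Bool) (l : List (List α)) {t : ℕ}
    (ht : t < l.length) :
    laneSum t ((js.map fun j => pack (l.map fun S => f S j)).map Prod.snd) =
      js.countP (f l[t]) := by
  induction js with
  | nil => rfl
  | cons j js ih =>
    rw [List.countP_cons, ← ih]
    simp only [laneSum, List.map_cons, List.sum_cons, pack, testBit_ofBits]
    rw [List.getD_eq_getElem _ _ (by simpa using ht), List.getElem_map, add_comm]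
    cases f l[t] j <;> rfl

theorem weightCounts_eq {d K k : ℕ} (hk : k ≤ K) (is : List α) (js : List β) (hjs : js ≠ [])
    (hjs' : js.length < 64) (hd : is.length.choose k ≤ 2 ^ d) (A : α → β → Bool) (ms : List ℕ) :
    weightCounts d K k (js.map fun j => is.map fun i => A i j) ms =
      ms.map fun m => (is.sublistsLen k).countP fun S =>
        js.countP (fun j => parity (S.map fun i => A i j)) = m := by
  obtain ⟨j₀, js', rfl⟩ := List.exists_cons_of_ne_nil hjs
  unfold weightCounts
  dsimp only
  rw [parity_column A hk]
  set l := is.sublistsLen k with hl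
  have hN : (((j₀ :: js').map fun j => pack (l.map fun S => parity (S.map fun i => A i j))).headD
      (0, 0)).1 = l.length := by simp [pack]
  rw [hN]
  refine List.map_congr_left fun m _ => ?_
  have hflag : eqFlag (bitMask l.length) (laneDigits 6 (((j₀ :: js').map fun j =>
      pack (l.map fun S => parity (S.map fun i => A i j))).map Prod.snd)) m =
      ofBits (l.map fun S => decide ((j₀ :: js').countP
        (fun j => parity (S.map fun i => A i j)) = m)) := by
    refine Nat.eq_of_testBit_eq fun t => ?_
    rw [testBit_eqFlag, testBit_ofBits, laneValue_laneDigits _ _ _ (by simpa using hjs')]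
    by_cases ht : t < l.length
    · rw [laneSum_columns _ (fun S j => parity (S.map fun i => A i j)) l ht,
        List.getD_eq_getElem _ _ (by simpa using ht)]
      simp [ht]
    · rw [List.getD_eq_default _ _ (by simpa using ht)]
      simp [ht]
  rw [hflag, popCount_ofBits _ _ (by simpa [hl, List.length_sublistsLen] using hd),
    List.count_eq_countP, List.countP_map]
  refine List.countP_congr fun S _ => ?_
  simp

theorem natCast_parity (l : List Bool) :
    (if parity l then 1 else 0 : ZMod 2) = (l.map fun b => if b then (1 : ZMod 2) else 0).sum := by
  induction l with
  | nil => rfl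
  | cons b l ih =>
    rw [List.map_cons, List.sum_cons, ← ih]
    change (if xor b (parity l) then (1 : ZMod 2) else 0) = _
    cases b <;> cases parity l <;> decide

end Counting

end BitSliced

open BitSliced

section Systematic

variable {n : ℕ}

/-- The binary matrix with given entries. -/
def boolMatrix (A : Fin n → Fin n → Bool) : Matrix (Fin n) (Fin n) (ZMod 2) :=
  Matrix.of fun i j => if A i j then 1 else 0

open Matrix

theorem eq_ite_ne_zero (x : ZMod 2) : x = if x ≠ 0 then 1 else 0 := by
  revert x
  decide

theorem hamWt_eq_countP (u : Fin n → ZMod 2) :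
    hamWt u = (List.finRange n).countP fun i => u i ≠ 0 := by
  rw [hamWt, ← Multiset.coe_countP, Multiset.countP_eq_card_filter]
  rfl

theorem vecMul_boolMatrix (A : Fin n → Fin n → Bool) (u : Fin n → ZMod 2) (j : Fin n) :
    (u ᵥ* boolMatrix A) j =
      if parity (((List.finRange n).filter fun i => u i ≠ 0).map fun i => A i j) then 1 else 0 := by
  rw [natCast_parity, List.map_map]
  simp only [Matrix.vecMul, dotProduct, boolMatrix, Matrix.of_apply, Fin.sum_univ_def]
  induction List.finRange n with
  | nil => rfl
  | cons i l ih =>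
    rw [List.map_cons, List.sum_cons, ih, List.filter_cons]
    have h := eq_ite_ne_zero (u i)
    by_cases h0 : u i = 0
    · simp [h0]
    · rw [if_pos h0] at h
      simp [h]

/-- The number of vectors `u` of weight `k` for which `u ᵥ* M` has weight `m`. -/
def weightCard (M : Matrix (Fin n) (Fin n) (ZMod 2)) (k m : ℕ) : ℕ :=
  (Finset.univ.filter fun u : Fin n → ZMod 2 => hamWt u = k ∧ hamWt (u ᵥ* M) = m).card

theorem filter_mem_eq_of_sublist {S : List (Fin n)} (hS : S.Sublist (List.finRange n)) :
    ((List.finRange n).filter fun i => i ∈ S) = S := by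
  have hp : (List.finRange n).Pairwise (· < ·) := List.pairwise_lt_finRange n
  refine List.Perm.eq_of_pairwise (le := (· < ·)) (fun a b _ _ h h' => (h.asymm h').elim)
    (hp.sublist List.filter_sublist) (hp.sublist hS) ?_
  rw [List.perm_ext_iff_of_nodup ((List.nodup_finRange n).filter _)
    ((List.nodup_finRange n).sublist hS)]
  simp

theorem weightCard_boolMatrix (A : Fin n → Fin n → Bool) (k m : ℕ) :
    weightCard (boolMatrix A) k m = ((List.finRange n).sublistsLen k).countP fun S =>
      (List.finRange n).countP (fun j => parity (S.map fun i => A i j)) = m := by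
  rw [List.countP_eq_length_filter, ← List.toFinset_card_of_nodup
    ((List.nodup_sublistsLen k (List.nodup_finRange n)).filter _)]
  have hwt (u : Fin n → ZMod 2) : hamWt (u ᵥ* boolMatrix A) = (List.finRange n).countP fun j =>
      parity (((List.finRange n).filter fun i => u i ≠ 0).map fun i => A i j) := by
    rw [hamWt_eq_countP]
    refine List.countP_congr fun j _ => ?_
    rw [vecMul_boolMatrix]
    simp
  refine Finset.card_bij (fun u _ => (List.finRange n).filter fun i => u i ≠ 0) ?_ ?_ ?_
  · intro u hu
    rw [Finset.mem_filter, hwt, hamWt_eq_countP, List.countP_eq_length_filter] at hu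
    simp only [List.mem_toFinset, List.mem_filter, List.mem_sublistsLen, decide_eq_true_eq]
    exact ⟨⟨List.filter_sublist, hu.2.1⟩, hu.2.2⟩
  · intro u _ v _ huv
    funext i
    have h : i ∈ (List.finRange n).filter (fun i => u i ≠ 0) ↔
      i ∈ (List.finRange n).filter (fun i => v i ≠ 0) := by rw [huv]
    rw [eq_ite_ne_zero (u i), eq_ite_ne_zero (v i)]
    simp only [List.mem_filter, List.mem_finRange, true_and, decide_eq_true_eq] at h
    simp only [h]
  · intro S hS
    simp only [List.mem_toFinset, List.mem_filter, List.mem_sublistsLen, decide_eq_true_eq] at hS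
    have hf : ((List.finRange n).filter fun i => (if i ∈ S then (1 : ZMod 2) else 0) ≠ 0) = S := by
      refine Eq.trans ?_ (filter_mem_eq_of_sublist hS.1.1)
      refine List.filter_congr fun i _ => ?_
      simp
    refine ⟨fun i => if i ∈ S then 1 else 0, ?_, hf⟩
    rw [Finset.mem_filter, hwt, hamWt_eq_countP, List.countP_eq_length_filter, hf]
    exact ⟨Finset.mem_univ _, hS.1.2, hS.2⟩

theorem weightCard_transpose {M : Matrix (Fin n) (Fin n) (ZMod 2)} (hM : M * Mᵀ = 1) (k m : ℕ) :
    weightCard Mᵀ m k = weightCard M k m := by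
  have hM' : Mᵀ * M = 1 := mul_eq_one_comm.1 hM
  refine Finset.card_bij' (fun u _ => u ᵥ* Mᵀ) (fun u _ => u ᵥ* M) ?_ ?_ ?_ ?_ <;>
    simp [Matrix.vecMul_vecMul, hM, hM', and_comm]

/-- The code with generator matrix `(I | M)`. -/
def systematicCode (M : Matrix (Fin n) (Fin n) (ZMod 2)) :
    Submodule (ZMod 2) (Fin (n + n) → ZMod 2) where
  carrier := {v | (fun j => v (Fin.natAdd n j)) = (fun i => v (Fin.castAdd n i)) ᵥ* M}
  zero_mem' := by
    change (0 : Fin n → ZMod 2) = 0 ᵥ* M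
    simp
  add_mem' {v w} hv hw := by
    change (fun j => v (Fin.natAdd n j)) + (fun j => w (Fin.natAdd n j)) =
      ((fun i => v (Fin.castAdd n i)) + fun i => w (Fin.castAdd n i)) ᵥ* M
    rw [Matrix.add_vecMul, ← hv, ← hw]
  smul_mem' c v hv := by
    change c • (fun j => v (Fin.natAdd n j)) = (c • fun i => v (Fin.castAdd n i)) ᵥ* M
    rw [Matrix.smul_vecMul, ← hv]

theorem mem_systematicCode {M : Matrix (Fin n) (Fin n) (ZMod 2)} {v : Fin (n + n) → ZMod 2} :
    v ∈ systematicCode M ↔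
      (fun j => v (Fin.natAdd n j)) = (fun i => v (Fin.castAdd n i)) ᵥ* M := Iff.rfl

theorem append_mem_systematicCode {M : Matrix (Fin n) (Fin n) (ZMod 2)} (u : Fin n → ZMod 2) :
    Fin.append u (u ᵥ* M) ∈ systematicCode M := by
  simp only [mem_systematicCode, Fin.append_right, Fin.append_left]

theorem isSelfDual_systematicCode {M : Matrix (Fin n) (Fin n) (ZMod 2)} (hM : M * Mᵀ = 1) :
    IsSelfDual (systematicCode M) := by
  have hM' : Mᵀ * M = 1 := mul_eq_one_comm.1 hM
  intro x
  set p : Fin n → ZMod 2 := fun i => x (Fin.castAdd n i) with hp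
  set q : Fin n → ZMod 2 := fun i => x (Fin.natAdd n i) with hq
  have key (y : Fin n → ZMod 2) : p ⬝ᵥ y + q ⬝ᵥ (y ᵥ* M) = (p + q ᵥ* Mᵀ) ⬝ᵥ y := by
    rw [add_dotProduct, Matrix.vecMul_transpose, dotProduct_comm q, ← Matrix.dotProduct_mulVec,
      dotProduct_comm y]
  have hiff : x ∈ systematicCode M ↔ p + q ᵥ* Mᵀ = 0 := by
    rw [mem_systematicCode, add_eq_zero_iff_eq_neg, ZModModule.neg_eq_self]
    constructor
    · intro h
      change q = p ᵥ* M at h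
      rw [h, Matrix.vecMul_vecMul, hM, Matrix.vecMul_one]
    · intro h
      change q = p ᵥ* M
      rw [h, Matrix.vecMul_vecMul, hM', Matrix.vecMul_one]
  rw [hiff]
  constructor
  · intro h y hy
    rw [Fin.sum_univ_add]
    have := key fun i => y (Fin.castAdd n i)
    rw [← mem_systematicCode.1 hy, h, zero_dotProduct] at this
    exact this
  · intro h
    refine dotProduct_eq_zero _ fun y => ?_
    rw [← key y]
    have := h _ (append_mem_systematicCode (M := M) y)
    rw [Fin.sum_univ_add] at this
    simp only [Fin.append_right, Fin.append_left] at this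
    exact this

theorem hamWt_eq_add (v : Fin (n + n) → ZMod 2) :
    hamWt v = hamWt (fun i => v (Fin.castAdd n i)) + hamWt fun i => v (Fin.natAdd n i) := by
  simp only [hamWt, Finset.card_filter, Fin.sum_univ_add]

theorem card_systematicCode (M : Matrix (Fin n) (Fin n) (ZMod 2)) (w : ℕ) :
    Nat.card {v : Fin (n + n) → ZMod 2 // v ∈ systematicCode M ∧ hamWt v = w} =
      ∑ p ∈ Finset.HasAntidiagonal.antidiagonal w, weightCard M p.1 p.2 := by
  have h : Nat.card {v : Fin (n + n) → ZMod 2 // v ∈ systematicCode M ∧ hamWt v = w} =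
      (Finset.univ.filter fun u : Fin n → ZMod 2 => hamWt u + hamWt (u ᵥ* M) = w).card := by
    rw [← Fintype.card_subtype, ← Nat.card_eq_fintype_card]
    refine Nat.card_congr
      { toFun := fun v => ⟨fun i => v.1 (Fin.castAdd n i), ?_⟩
        invFun := fun u => ⟨Fin.append u.1 (u.1 ᵥ* M), append_mem_systematicCode _, ?_⟩
        left_inv := fun v => Subtype.ext ?_
        right_inv := fun u => Subtype.ext ?_ }
    · rw [← mem_systematicCode.1 v.2.1, ← hamWt_eq_add, v.2.2]
    · rw [hamWt_eq_add]
      simpa only [Fin.append_right, Fin.append_left] using u.2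
    · dsimp only
      rw [← mem_systematicCode.1 v.2.1]
      exact Fin.append_castAdd_natAdd
    · funext i
      exact Fin.append_left _ _ i
  rw [h]
  simp only [weightCard]
  rw [Finset.card_eq_sum_card_fiberwise (f := fun u => (hamWt u, hamWt (u ᵥ* M)))
    (t := Finset.HasAntidiagonal.antidiagonal w) (by intro u; simp)]
  refine Finset.sum_congr rfl fun p hp => ?_
  congr 1
  ext u
  rw [Finset.HasAntidiagonal.mem_antidiagonal] at hp
  simp only [Finset.mem_filter, Finset.mem_univ, true_and, Prod.ext_iff]
  exact ⟨fun h => h.2, fun h => ⟨by rw [h.1, h.2, hp], h⟩⟩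

end Systematic

/-- The entries of the four-circulant matrix `[[A, B], [Bᵀ, Aᵀ]]`, where `A` and `B` are the
circulant matrices of order 18 whose first rows are the binary expansions of 18047 and 4283. -/
def fourCirculant (i j : Fin 36) : Bool :=
  if i.val < 18 then
    if j.val < 18 then Nat.testBit 18047 ((j + 18 - i) % 18) else Nat.testBit 4283 ((j - i) % 18)
  else
    if j.val < 18 then Nat.testBit 4283 ((i - j) % 18) else Nat.testBit 18047 ((i + 18 - j) % 18)

theorem fourCirculant_mul_transpose :
    boolMatrix fourCirculant * (boolMatrix fourCirculant).transpose = 1 := by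
  have h : ∀ i j : Fin 36, parity ((List.finRange 36).map fun k =>
      fourCirculant i k && fourCirculant j k) = decide (i = j) := by decide +kernel
  ext i j
  have := natCast_parity ((List.finRange 36).map fun k => fourCirculant i k && fourCirculant j k)
  rw [h, List.map_map] at this
  rw [Matrix.mul_apply, Fin.sum_univ_def, Matrix.one_apply]
  simp only [decide_eq_true_eq] at this
  rw [this]
  refine congrArg _ (List.map_congr_left fun k _ => ?_)
  simp only [boolMatrix, Matrix.transpose_apply, Matrix.of_apply, Function.comp_apply]
  cases fourCirculant i k <;> cases fourCirculant j k <;> rfl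

theorem boolMatrix_transpose {n : ℕ} (A : Fin n → Fin n → Bool) :
    (boolMatrix A).transpose = boolMatrix fun i j => A j i := rfl

/-- The number of codewords of total weight at most 14 whose halves have weights `k` and `m`. -/
def pairCount : ℕ → ℕ → ℕ
  | 0, 0 => 1
  | 3, 11 => 144
  | 5, 9 => 2160
  | 6, 6 => 204
  | 7, 7 => 4320
  | 8, 4 => 18
  | 9, 5 => 1908
  | 10, 2 => 18
  | 11, 3 => 108
  | _, _ => 0

theorem weightCounts_fourCirculant : ∀ k < 8,
    weightCounts 23 7 k ((List.finRange 36).map fun j => (List.finRange 36).map fun i =>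
      fourCirculant i j) (List.range (15 - k)) =
        (List.range (15 - k)).map fun m => pairCount k m := by
  decide +kernel

theorem weightCounts_fourCirculant_transpose : ∀ k < 7,
    weightCounts 23 7 k ((List.finRange 36).map fun j => (List.finRange 36).map fun i =>
      fourCirculant j i) (List.range (15 - k)) =
        (List.range (15 - k)).map fun m => pairCount m k := by
  decide +kernel

theorem weightCard_eq_of_weightCounts {n d K k m s : ℕ} (hk : k ≤ K) (hn : 0 < n) (hn' : n < 64)
    (hd : n.choose k ≤ 2 ^ d) {A : Fin n → Fin n → Bool} {f : ℕ → ℕ} (hm : m < s)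
    (h : weightCounts d K k ((List.finRange n).map fun j => (List.finRange n).map fun i => A i j)
      (List.range s) = (List.range s).map f) :
    weightCard (boolMatrix A) k m = f m := by
  rw [weightCounts_eq hk _ _ (by simpa [← List.length_eq_zero_iff] using hn.ne')
    (by simpa using hn') (by simpa using hd)] at h
  rw [weightCard_boolMatrix]
  exact List.map_inj_left.1 h m (List.mem_range.2 hm)

theorem weightCard_fourCirculant {k m : ℕ} (h : k + m ≤ 14) :
    weightCard (boolMatrix fourCirculant) k m = pairCount k m := by
  have hd : ∀ k < 8, Nat.choose 36 k ≤ 2 ^ 23 := by decide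
  rcases lt_or_ge k 8 with hk | hk
  · exact weightCard_eq_of_weightCounts (Nat.le_of_lt_succ hk) (by norm_num) (by norm_num)
      (hd k hk) (by omega) (weightCounts_fourCirculant k hk)
  · rw [← weightCard_transpose fourCirculant_mul_transpose, boolMatrix_transpose]
    exact weightCard_eq_of_weightCounts (f := fun m => pairCount m _) (by omega) (by norm_num)
      (by norm_num) (hd m (by omega)) (by omega)
      (weightCounts_fourCirculant_transpose m (by omega))

theorem card_weight_fourCirculant {w : ℕ} (h : w ≤ 14) :
    Nat.card {v // v ∈ systematicCode (boolMatrix fourCirculant) ∧ hamWt v = w} =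
      ∑ p ∈ Finset.HasAntidiagonal.antidiagonal w, pairCount p.1 p.2 := by
  rw [card_systematicCode]
  refine Finset.sum_congr rfl fun p hp => weightCard_fourCirculant ?_
  rwa [Finset.HasAntidiagonal.mem_antidiagonal.1 hp]

/-- There is a self-dual binary linear code of length 72 with minimum nonzero Hamming
weight 12, having exactly 240 codewords of weight 12 and exactly 8640 codewords of
weight 14 (weight enumerator `W_{72,1}` with γ = 0 and β = 120). -/
theorem exists_selfDual_code_72_gamma_0_beta_120 :
    ∃ C : Submodule (ZMod 2) (Fin 72 → ZMod 2),
      IsSelfDual C ∧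
      IsLeast {k | ∃ v ∈ C, v ≠ 0 ∧ hamWt v = k} 12 ∧
      Nat.card {v : Fin 72 → ZMod 2 // v ∈ C ∧ hamWt v = 12} = 240 ∧
      Nat.card {v : Fin 72 → ZMod 2 // v ∈ C ∧ hamWt v = 14} = 8640 := by
  have h12 := card_weight_fourCirculant (w := 12) (by norm_num)
  have h14 := card_weight_fourCirculant (w := 14) le_rfl
  rw [show ∑ p ∈ Finset.HasAntidiagonal.antidiagonal 12, pairCount p.1 p.2 = 240 by decide] at h12
  rw [show ∑ p ∈ Finset.HasAntidiagonal.antidiagonal 14, pairCount p.1 p.2 = 8640 by decide] at h14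
  refine ⟨systematicCode (boolMatrix fourCirculant),
    isSelfDual_systematicCode fourCirculant_mul_transpose, ⟨?_, ?_⟩, h12, h14⟩
  · have : Nonempty {v // v ∈ systematicCode (boolMatrix fourCirculant) ∧ hamWt v = 12} :=
      (Nat.card_pos_iff.1 (by rw [h12]; norm_num)).1
    obtain ⟨v, hv, hw⟩ := this
    refine ⟨v, hv, ?_, hw⟩
    rintro rfl
    simp [hamWt] at hw
  · rintro k ⟨v, hv, hv0, rfl⟩
    by_contra! hlt
    have hpos : hamWt v ≠ 0 := by
      intro h0
      refine hv0 (funext fun i => ?_)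
      by_contra hi
      exact Finset.notMem_empty i (Finset.card_eq_zero.1 h0 ▸
        Finset.mem_filter.2 ⟨Finset.mem_univ i, hi⟩)
    have hzero : ∀ w < 12, w ≠ 0 →
        ∑ p ∈ Finset.HasAntidiagonal.antidiagonal w, pairCount p.1 p.2 = 0 := by decide
    have hcard := card_weight_fourCirculant (w := hamWt v) (by omega)
    rw [hzero _ hlt hpos, Finite.card_eq_zero_iff] at hcard
    exact hcard.false ⟨v, hv, rfl⟩
end

section
/- There exists a self-dual binary linear code C ⊆ F₂^{72} whose minimum nonzero Hamming weight is 12, which contains exactly 384 codewords of Hamming weight 12 and exactly 8640 codewords of Hamming weight 14 (the weight enumerator W_{72,1} with γ = 0 and β = 192). -/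
namespace PackedCount

/-- The natural number whose binary digits, least significant first, are `bs`. -/
def pack : List Bool → ℕ
  | [] => 0
  | b :: bs => Nat.bit b (pack bs)

theorem pack_xor {α : Type*} (ws : List α) (f g : α → Bool) :
    Nat.xor (pack (ws.map f)) (pack (ws.map g)) = pack (ws.map fun w => f w ^^ g w) := by
  induction ws with
  | nil => simp [pack]
  | cons w ws ih =>
    simp only [List.map_cons, pack, ← ih]
    exact Nat.xor_bit ..

theorem pack_and {α : Type*} (ws : List α) (f g : α → Bool) :
    Nat.land (pack (ws.map f)) (pack (ws.map g)) = pack (ws.map fun w => f w && g w) := by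
  induction ws with
  | nil => simp [pack]
  | cons w ws ih =>
    simp only [List.map_cons, pack, ← ih]
    exact Nat.land_bit ..

theorem pack_or {α : Type*} (ws : List α) (f g : α → Bool) :
    Nat.lor (pack (ws.map f)) (pack (ws.map g)) = pack (ws.map fun w => f w || g w) := by
  induction ws with
  | nil => simp [pack]
  | cons w ws ih =>
    simp only [List.map_cons, pack, ← ih]
    exact Nat.lor_bit ..

theorem pack_append (as bs : List Bool) :
    Nat.lor (pack as) (Nat.shiftLeft (pack bs) as.length) = pack (as ++ bs) := by
  change pack as ||| pack bs <<< as.length = _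
  induction as with
  | nil => simp [pack]
  | cons a as ih =>
    have h : pack bs <<< (a :: as).length = Nat.bit false (pack bs <<< as.length) := by
      simp [Nat.shiftLeft_succ, Nat.bit_val]
    rw [h, pack, Nat.lor_bit, ih, Bool.or_false, List.cons_append, pack]

theorem pack_const_false {α : Type*} (ws : List α) : pack (ws.map fun _ => false) = 0 := by
  induction ws with
  | nil => rfl
  | cons w ws ih => rw [List.map_cons, pack, ih]; rfl

theorem pack_lt (bs : List Bool) : pack bs < 2 ^ bs.length := by
  induction bs with
  | nil => simp [pack]
  | cons b bs ih =>
    simp only [pack, Nat.bit_val, List.length_cons, pow_succ]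
    have := b.toNat_le
    omega

/-- The number of binary digits equal to `1` of a natural number below `2 ^ 2 ^ k`. -/
def popCount : ℕ → ℕ → ℕ
  | 0, x => x
  | k + 1, x =>
    if x = 0 then 0 else
      Nat.add
        (popCount k
          (Nat.xor (Nat.mod x (Nat.pow 2 (Nat.pow 2 k))) (Nat.shiftRight x (Nat.pow 2 k))))
        (Nat.mul 2
          (popCount k
            (Nat.land (Nat.mod x (Nat.pow 2 (Nat.pow 2 k))) (Nat.shiftRight x (Nat.pow 2 k)))))

theorem popCount_eq_sum (k x : ℕ) (hx : x < 2 ^ 2 ^ k) :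
    popCount k x = ∑ i ∈ Finset.range (2 ^ k), (x.testBit i).toNat := by
  induction k generalizing x with
  | zero =>
    have : x < 2 := by simpa using hx
    interval_cases x <;> rfl
  | succ k ih =>
    rw [popCount]
    by_cases h0 : x = 0
    · simp [h0]
    rw [if_neg h0]
    change popCount k ((x % 2 ^ 2 ^ k) ^^^ (x >>> 2 ^ k)) +
      2 * popCount k ((x % 2 ^ 2 ^ k) &&& (x >>> 2 ^ k)) = _
    have hlo : x % 2 ^ 2 ^ k < 2 ^ 2 ^ k := Nat.mod_lt _ (by positivity)
    have hhi : x >>> 2 ^ k < 2 ^ 2 ^ k := by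
      rw [Nat.shiftRight_eq_div_pow, Nat.div_lt_iff_lt_mul (by positivity), ← pow_add,
        ← two_mul, ← pow_succ']
      exact hx
    rw [ih _ (Nat.xor_lt_two_pow hlo hhi), ih _ (Nat.and_lt_two_pow _ hhi), pow_succ',
      two_mul (2 ^ k), Finset.sum_range_add, Finset.mul_sum, ← Finset.sum_add_distrib,
      ← Finset.sum_add_distrib]
    refine Finset.sum_congr rfl fun i hi => ?_
    rw [Nat.testBit_xor, Nat.testBit_and, Nat.testBit_mod_two_pow, Nat.testBit_shiftRight]
    simp only [Finset.mem_range.1 hi, decide_true, Bool.true_and]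
    cases x.testBit i <;> cases x.testBit (2 ^ k + i) <;> rfl

theorem sum_testBit_pack (bs : List Bool) (n : ℕ) (h : bs.length ≤ n) :
    ∑ i ∈ Finset.range n, ((pack bs).testBit i).toNat = bs.count true := by
  induction bs generalizing n with
  | nil => simp [pack]
  | cons b bs ih =>
    obtain ⟨n, rfl⟩ : ∃ m, n = m + 1 := ⟨n - 1, by simp at h; omega⟩
    rw [Finset.sum_range_succ', pack]
    simp only [Nat.testBit_bit_succ, Nat.testBit_bit_zero]
    rw [ih n (by simpa using h)]
    cases b <;> simp

theorem popCount_pack {α : Type*} (k : ℕ) (ws : List α) (p : α → Bool) (h : ws.length ≤ 2 ^ k) :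
    popCount k (pack (ws.map p)) = ws.countP p := by
  rw [popCount_eq_sum, sum_testBit_pack]
  · simp [List.count, List.countP_map, Function.comp_def]
  · simpa using h
  · refine (pack_lt _).trans_le (Nat.pow_le_pow_right two_pos ?_)
    simpa using h

/-- `IsCounter ws cs f` says that the packed vectors `cs` hold, in the lane of each `w ∈ ws`,
the binary digits of `f w`. -/
def IsCounter {α : Type*} (ws : List α) (cs : List ℕ) (f : α → ℕ) : Prop :=
  ∃ fs : List (α → Bool), cs = fs.map (fun g => pack (ws.map g)) ∧
    ∀ w, pack (fs.map fun g => g w) = f w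

/-- Add a one-digit packed number to a packed number. -/
def addBit : List ℕ → ℕ → List ℕ
  | [], c => [c]
  | a :: as, c => Nat.xor a c :: addBit as (Nat.land a c)

theorem IsCounter.addBit {α : Type*} {ws : List α} {cs : List ℕ} {f : α → ℕ}
    (h : IsCounter ws cs f) (g : α → Bool) :
    IsCounter ws (addBit cs (pack (ws.map g))) fun w => f w + (g w).toNat := by
  obtain ⟨fs, rfl, hf⟩ := h
  induction fs generalizing f g with
  | nil =>
    refine ⟨[g], rfl, fun w => ?_⟩
    beta_reduce
    rw [← hf w]
    cases h : g w <;> simp [pack, h]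
  | cons a fs ih =>
    obtain ⟨fs', h₁, h₂⟩ := ih (f := fun w => pack (fs.map fun g => g w))
      (fun w => a w && g w) (fun _ => rfl)
    refine ⟨(fun w => a w ^^ g w) :: fs', ?_, fun w => ?_⟩
    · simp only [List.map_cons, PackedCount.addBit, pack_xor, pack_and, h₁]
    · beta_reduce
      rw [List.map_cons, pack, h₂ w, ← hf w, List.map_cons, pack]
      beta_reduce
      cases a w <;> cases g w <;> (simp [Nat.bit_val]; try omega)

/-- Add two packed numbers and a carry. -/
def addCarry : List ℕ → List ℕ → ℕ → List ℕ
  | [], bs, c => addBit bs c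
  | a :: as, [], c => addBit (a :: as) c
  | a :: as, b :: bs, c =>
    Nat.xor (Nat.xor a b) c ::
      addCarry as bs (Nat.lor (Nat.land a b) (Nat.land (Nat.xor a b) c))

theorem IsCounter.addCarry {α : Type*} {ws : List α} {cs ds : List ℕ} {f f' : α → ℕ}
    (h : IsCounter ws cs f) (h' : IsCounter ws ds f') (g : α → Bool) :
    IsCounter ws (addCarry cs ds (pack (ws.map g))) fun w => f w + f' w + (g w).toNat := by
  obtain ⟨fs, rfl, hf⟩ := h
  induction fs generalizing f f' g ds with
  | nil =>
    obtain rfl : f = fun _ => 0 := funext fun w => (hf w).symm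
    simpa [PackedCount.addCarry] using h'.addBit g
  | cons a fs ih =>
    obtain ⟨fs', rfl, hf'⟩ := h'
    cases fs' with
    | nil =>
      obtain rfl : f' = fun _ => 0 := funext fun w => (hf' w).symm
      simpa [PackedCount.addCarry] using
        IsCounter.addBit (ws := ws) (f := f) ⟨a :: fs, rfl, hf⟩ g
    | cons b fs' =>
      obtain ⟨fs'', h₁, h₂⟩ := ih (f := fun w => pack (fs.map fun g => g w))
        (f' := fun w => pack (fs'.map fun g => g w))
        ⟨fs', rfl, fun _ => rfl⟩ (fun w => (a w && b w) || ((a w ^^ b w) && g w)) (fun _ => rfl)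
      refine ⟨(fun w => (a w ^^ b w) ^^ g w) :: fs'', ?_, fun w => ?_⟩
      · simp only [List.map_cons, PackedCount.addCarry, pack_xor, pack_and, pack_or, h₁]
      · beta_reduce
        rw [List.map_cons, pack, h₂ w, ← hf w, ← hf' w, List.map_cons, List.map_cons, pack, pack]
        beta_reduce
        cases a w <;> cases b w <;> cases g w <;> simp [Nat.bit_val] <;> omega

/-- In each lane, the number of packed vectors with a `1` in that lane. -/
def sumCols : List ℕ → List ℕ
  | a :: b :: c :: cs => addCarry (addCarry [a] [b] c) (sumCols cs) 0
  | [a, b] => addCarry [a] [b] 0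
  | [a] => [a]
  | [] => []

theorem isCounter_singleton {α : Type*} (ws : List α) (g : α → Bool) :
    IsCounter ws [pack (ws.map g)] fun w => (g w).toNat :=
  ⟨[g], rfl, fun w => by cases h : g w <;> simp [pack, h]⟩

theorem isCounter_sumCols {α : Type*} (ws : List α) : ∀ gs : List (α → Bool),
    IsCounter ws (sumCols (gs.map fun g => pack (ws.map g)))
      fun w => (gs.map fun g => (g w).toNat).sum
  | [] => ⟨[], rfl, fun _ => rfl⟩
  | [a] => by simpa [sumCols] using isCounter_singleton ws a
  | [a, b] => by
    have h := (isCounter_singleton ws a).addCarry (isCounter_singleton ws b) fun _ => false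
    rw [pack_const_false] at h
    simpa [sumCols] using h
  | a :: b :: c :: gs => by
    have h := ((isCounter_singleton ws a).addCarry (isCounter_singleton ws b) c).addCarry
      (isCounter_sumCols ws gs) fun _ => false
    rw [pack_const_false] at h
    simpa [sumCols, add_assoc] using h

/-- The packed vector marking the lanes in which the packed number equals `n`;
`ones` is the all-ones vector. -/
def eqMask (ones : ℕ) : List ℕ → ℕ → ℕ
  | [], n => if n = 0 then ones else 0
  | b :: bs, n =>
    Nat.land (if Nat.mod n 2 = 1 then b else Nat.xor b ones)
      (eqMask ones bs (Nat.div n 2))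

theorem IsCounter.eqMask {α : Type*} {ws : List α} {cs : List ℕ} {f : α → ℕ}
    (h : IsCounter ws cs f) (n : ℕ) :
    eqMask (pack (ws.map fun _ => true)) cs n = pack (ws.map fun w => decide (f w = n)) := by
  obtain ⟨fs, rfl, hf⟩ := h
  obtain rfl : f = fun w => pack (fs.map fun g => g w) := funext fun w => (hf w).symm
  clear hf
  induction fs generalizing n with
  | nil =>
    by_cases hn : n = 0
    · simp [PackedCount.eqMask, pack, hn]
    · simp only [PackedCount.eqMask, List.map_nil, pack, if_neg hn, Ne.symm hn, decide_false,
        pack_const_false]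
  | cons a fs ih =>
    have hd : (if Nat.mod n 2 = 1 then pack (ws.map a)
        else Nat.xor (pack (ws.map a)) (pack (ws.map fun _ => true))) =
        pack (ws.map fun w => a w == decide (n % 2 = 1)) := by
      rw [pack_xor]
      split_ifs with h
      · simp [show n % 2 = 1 from h]
      · simp [show ¬ n % 2 = 1 from h]
    simp only [List.map_cons, PackedCount.eqMask]
    rw [hd, ih, pack_and]
    congr 2
    funext w
    rw [Bool.eq_iff_iff]
    change _ ↔ decide (Nat.bit (a w) _ = n) = true
    have hn : Nat.div n 2 = n / 2 := rfl
    rw [hn, Nat.bit_val]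
    cases a w <;> simp <;> omega


/-- A list of binary words, stored column by column: `cols` holds the packed vectors of the digits
of the words, and `ones` the packed all-ones vector. -/
structure PackedWords where
  len : ℕ
  ones : ℕ
  cols : List ℕ

/-- Append to the words with columns `xs` the words with columns `ys` shifted by `r`. -/
def appendCols (len ones : ℕ) : List Bool → List ℕ → List ℕ → List ℕ
  | b :: r, x :: xs, y :: ys =>
    Nat.lor x (Nat.shiftLeft (bif b then Nat.xor y ones else y) len) ::
      appendCols len ones r xs ys
  | _, _, _ => []

/-- Append to the words of `c` the words of `d` shifted by `r`. -/
def PackedWords.append (r : List Bool) (c d : PackedWords) : PackedWords :=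
  ⟨Nat.add c.len d.len, Nat.lor c.ones (Nat.shiftLeft d.ones c.len),
    appendCols c.len d.ones r c.cols d.cols⟩

/-- Pass from the sums of `0, 1, 2, …` of the rows of a matrix to those of the matrix
with the additional row `r`. -/
def addRow (r : List Bool) : List PackedWords → List PackedWords
  | [] => []
  | c :: cs => c :: List.zipWith (PackedWords.append r) cs (c :: cs)

/-- The sums of `0, 1, …, k` of the given rows, each of which has `m` digits. -/
def rowSums (m k : ℕ) : List (List Bool) → List PackedWords
  | [] => ⟨1, 1, List.replicate m 0⟩ :: List.replicate k ⟨0, 0, List.replicate m 0⟩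
  | r :: rs => addRow r (rowSums m k rs)

/-- The numbers of words of the weights `ts`. -/
def PackedWords.weightCounts (fuel : ℕ) (c : PackedWords) (ts : List ℕ) : List ℕ :=
  ts.map fun t => popCount fuel (eqMask c.ones (sumCols c.cols) t)

/-- The indicator of being nonzero. -/
def bit (a : ZMod 2) : Bool := decide (a ≠ 0)

theorem bit_add : ∀ a b : ZMod 2, bit (a + b) = (bit a ^^ bit b) := by decide

theorem bit_mul : ∀ a b : ZMod 2, bit (a * b) = (bit a && bit b) := by decide

theorem bit_injective : Function.Injective bit := by decide

/-- `c` stores the words `ws`. -/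
def PackedWords.Rep {m : ℕ} (c : PackedWords) (ws : List (Fin m → ZMod 2)) : Prop :=
  c.len = ws.length ∧ c.ones = pack (ws.map fun _ => true) ∧
    c.cols = (List.finRange m).map fun j => pack (ws.map fun w => bit (w j))

theorem appendCols_eq {m : ℕ} (js : List (Fin m)) (r : Fin m → ZMod 2)
    (ws vs : List (Fin m → ZMod 2)) :
    appendCols ws.length (pack (vs.map fun _ => true)) (js.map fun j => bit (r j))
      (js.map fun j => pack (ws.map fun w => bit (w j)))
      (js.map fun j => pack (vs.map fun w => bit (w j))) =
    js.map fun j => pack ((ws ++ vs.map (r + ·)).map fun w => bit (w j)) := by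
  induction js with
  | nil => rfl
  | cons j js ih =>
    have h : (bif bit (r j) then
          Nat.xor (pack (vs.map fun w => bit (w j))) (pack (vs.map fun _ => true))
        else pack (vs.map fun w => bit (w j))) =
        pack ((vs.map (r + ·)).map fun w => bit (w j)) := by
      rw [pack_xor, List.map_map]
      cases h : bit (r j) <;> simp [Function.comp_def, bit_add, h]
    simp only [List.map_cons, appendCols, h, ih, List.map_append]
    rw [← pack_append, List.length_map]

theorem PackedWords.Rep.append {m : ℕ} {c d : PackedWords} {ws vs : List (Fin m → ZMod 2)}
    (hc : c.Rep ws) (hd : d.Rep vs) (r : Fin m → ZMod 2) :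
    (c.append ((List.finRange m).map fun j => bit (r j)) d).Rep (ws ++ vs.map (r + ·)) := by
  obtain ⟨hc₁, hc₂, hc₃⟩ := hc
  obtain ⟨hd₁, hd₂, hd₃⟩ := hd
  refine ⟨?_, ?_, ?_⟩
  · simp [PackedWords.append, hc₁, hd₁]
  · have h := pack_append (ws.map fun _ => true) (vs.map fun _ => true)
    rw [List.length_map] at h
    simp only [PackedWords.append, hc₁, hc₂, hd₂, h, List.map_append, List.map_map]
    rfl
  · simp only [PackedWords.append, hc₁, hc₃, hd₂, hd₃, appendCols_eq]

/-- The sums of `l` of the given vectors. -/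
def sums {M : Type*} [AddCommMonoid M] : List M → ℕ → List M
  | _, 0 => [0]
  | [], _ + 1 => []
  | r :: rs, l + 1 => sums rs (l + 1) ++ (sums rs l).map (r + ·)

theorem coe_sums {M : Type*} [AddCommMonoid M] (rs : List M) (l : ℕ) :
    (sums rs l : Multiset M) = ((rs : Multiset M).powersetCard l).map Multiset.sum := by
  induction rs generalizing l with
  | nil => cases l <;> simp [sums, Multiset.powersetCard_zero_right]
  | cons r rs ih =>
    cases l with
    | zero => simp [sums]
    | succ l =>
      rw [sums, ← Multiset.coe_add, ← Multiset.map_coe, ih, ih, ← Multiset.cons_coe,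
        Multiset.powersetCard_cons, Multiset.map_add, Multiset.map_map, Multiset.map_map]
      simp

theorem rep_zero {m : ℕ} : PackedWords.Rep ⟨1, 1, List.replicate m 0⟩ [(0 : Fin m → ZMod 2)] := by
  refine ⟨rfl, rfl, ?_⟩
  symm
  rw [List.eq_replicate_iff]
  simp [pack, bit]

theorem rep_nil {m : ℕ} :
    PackedWords.Rep ⟨0, 0, List.replicate m 0⟩ ([] : List (Fin m → ZMod 2)) := by
  refine ⟨rfl, rfl, ?_⟩
  symm
  rw [List.eq_replicate_iff]
  simp [pack]

theorem rowSums_rep {m : ℕ} (k : ℕ) (rs : List (Fin m → ZMod 2)) :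
    List.Forall₂ PackedWords.Rep
      (rowSums m k (rs.map fun r => (List.finRange m).map fun j => bit (r j)))
      ((List.range (k + 1)).map (sums rs)) := by
  induction rs with
  | nil =>
    rw [List.range_succ_eq_map, List.map_cons, List.map_map]
    refine .cons (by simpa [sums] using rep_zero) ?_
    rw [List.forall₂_iff_get]
    refine ⟨by simp, fun i h₁ h₂ => ?_⟩
    simpa [sums] using rep_nil
  | cons r rs ih =>
    rw [List.map_cons, rowSums]
    rw [List.forall₂_iff_get] at ih ⊢
    obtain ⟨hl, ih⟩ := ih
    generalize rowSums m k _ = t at *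
    cases t with
    | nil => simp at hl
    | cons c cs =>
      have hl' : cs.length = k := by simpa using hl
      refine ⟨by simp [addRow, hl'], fun i h₁ h₂ => ?_⟩
      cases i with
      | zero => simpa [addRow, sums] using ih 0 (by simp) (by simp)
      | succ i =>
        have hi : i < k := by simpa using h₂
        simpa [addRow, sums] using
          (ih (i + 1) (by simpa [hl'] using hi) (by simpa using hi)).append
            (ih i (by simp [hl']; omega) (by simp; omega)) r

theorem PackedWords.Rep.weightCounts {m fuel : ℕ} {c : PackedWords}
    {ws : List (Fin m → ZMod 2)} (h : c.Rep ws) (hf : ws.length ≤ 2 ^ fuel) (ts : List ℕ) :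
    c.weightCounts fuel ts = ts.map fun t => ws.countP fun w => decide (hamWt w = t) := by
  obtain ⟨-, h₂, h₃⟩ := h
  refine List.map_congr_left fun t _ => ?_
  have hs := isCounter_sumCols ws ((List.finRange m).map fun j w => bit (w j))
  rw [List.map_map] at hs
  rw [h₂, h₃]
  erw [hs.eqMask]
  rw [popCount_pack _ _ _ hf]
  congr 1
  funext w
  congr 1
  rw [hamWt, Finset.card_filter, List.map_map, ← List.ofFn_eq_map, List.sum_ofFn]
  simp [bit, Bool.toNat, Bool.cond_decide]

/-- The number of vectors of weight `w` whose product with `M` has weight `s`. -/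
def weightPairCount {n : ℕ} (M : Matrix (Fin n) (Fin n) (ZMod 2)) (w s : ℕ) : ℕ :=
  (Finset.univ.filter fun x : Fin n → ZMod 2 => hamWt x = w ∧ hamWt (Matrix.vecMul x M) = s).card

/-- The indicator vector of a finite set. -/
def indicator {n : ℕ} (S : Finset (Fin n)) (i : Fin n) : ZMod 2 := if i ∈ S then 1 else 0

theorem hamWt_indicator {n : ℕ} (S : Finset (Fin n)) : hamWt (indicator S) = S.card := by
  simp [hamWt, indicator]

theorem vecMul_indicator {n : ℕ} (M : Matrix (Fin n) (Fin n) (ZMod 2)) (S : Finset (Fin n)) :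
    Matrix.vecMul (indicator S) M = ∑ i ∈ S, M.row i := by
  ext j
  simp [indicator, Matrix.vecMul, dotProduct]

theorem indicator_support {n : ℕ} (x : Fin n → ZMod 2) :
    indicator (Finset.univ.filter fun i => x i ≠ 0) = x := by
  have h : ∀ a : ZMod 2, (if a ≠ 0 then 1 else 0) = a := by decide
  funext i
  simpa [indicator] using h (x i)

theorem support_indicator {n : ℕ} (S : Finset (Fin n)) :
    (Finset.univ.filter fun i => indicator S i ≠ 0) = S := by
  ext i
  simp [indicator]

theorem countP_sums {n : ℕ} (M : Matrix (Fin n) (Fin n) (ZMod 2)) (w s : ℕ) :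
    (sums ((List.finRange n).map M.row) w).countP (fun v => decide (hamWt v = s)) =
      weightPairCount M w s := by
  have h : ((List.finRange n : List (Fin n)) : Multiset (Fin n)) = Finset.univ.val := rfl
  rw [← Multiset.coe_countP, coe_sums, ← Multiset.map_coe, Multiset.powersetCard_map,
    Multiset.map_map, h, ← Finset.map_val_val_powersetCard, Multiset.map_map, Multiset.countP_map,
    weightPairCount]
  change ((Finset.univ.powersetCard w).filter fun S => hamWt (∑ i ∈ S, M.row i) = s).card = _
  refine Finset.card_bij' (fun S _ => indicator S)
    (fun x _ => Finset.univ.filter fun i => x i ≠ 0) (fun S hS => ?_) (fun x hx => ?_)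
    (fun S _ => support_indicator S) (fun x _ => indicator_support x)
  · simpa [hamWt_indicator, vecMul_indicator, Finset.mem_powersetCard] using hS
  · rw [Finset.mem_filter, Finset.mem_powersetCard, ← vecMul_indicator, indicator_support]
    exact ⟨⟨Finset.subset_univ _, (Finset.mem_filter.1 hx).2.1⟩, (Finset.mem_filter.1 hx).2.2⟩

theorem zipWith_weightCounts {n fuel k : ℕ} (M : Matrix (Fin n) (Fin n) (ZMod 2))
    {d : Fin n → Fin n → Bool} (hd : ∀ i j, bit (M i j) = d i j)
    (hf : ∀ w ≤ k, n.choose w ≤ 2 ^ fuel) (ts : List (List ℕ)) :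
    List.zipWith (fun w => List.map (weightPairCount M w)) (List.range (k + 1)) ts =
    List.zipWith (PackedWords.weightCounts fuel)
      (rowSums n k ((List.finRange n).map fun i => (List.finRange n).map fun j => d i j)) ts := by
  obtain rfl : (fun i j => bit (M i j)) = d := funext₂ hd
  symm
  have h := rowSums_rep k ((List.finRange n).map M.row)
  rw [List.map_map] at h
  change List.Forall₂ _ (rowSums n k
    ((List.finRange n).map fun i => (List.finRange n).map fun j => bit (M i j))) _ at h
  rw [List.forall₂_iff_get] at h
  obtain ⟨hl, h⟩ := h
  refine List.ext_getElem (by simpa using congrArg (min · ts.length) hl) fun i h₁ h₂ => ?_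
  have hi : i < k + 1 := by simp at h₂; omega
  have hts : i < ts.length := by simp at h₂; omega
  have hr := h i (by simp at h₁; exact h₁.1) (by simpa using hi)
  simp only [List.getElem_zipWith, List.getElem_range]
  simp only [List.get_eq_getElem, List.getElem_map, List.getElem_range] at hr
  have := hr.weightCounts (fuel := fuel) ?_ ts[i]
  · rw [← funext (countP_sums M i)]
    exact this
  · have := congrArg Multiset.card (coe_sums ((List.finRange n).map M.row) i)
    simp only [Multiset.coe_card, Multiset.card_map, Multiset.card_powersetCard, List.length_map,
      List.length_finRange] at this
    exact this.trans_le (hf i (by omega))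

/-- The left half of a vector. -/
def fstHalf {n : ℕ} (v : Fin (n + n) → ZMod 2) (i : Fin n) : ZMod 2 := v (Fin.castAdd n i)

/-- The right half of a vector. -/
def sndHalf {n : ℕ} (v : Fin (n + n) → ZMod 2) (i : Fin n) : ZMod 2 := v (Fin.natAdd n i)

@[simp]
theorem fstHalf_append {n : ℕ} (x y : Fin n → ZMod 2) : fstHalf (Fin.append x y) = x :=
  funext fun i => Fin.append_left x y i

@[simp]
theorem sndHalf_append {n : ℕ} (x y : Fin n → ZMod 2) : sndHalf (Fin.append x y) = y :=
  funext fun i => Fin.append_right x y i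

/-- The code with generator matrix `[1 | M]`. -/
def doubleCode {n : ℕ} (M : Matrix (Fin n) (Fin n) (ZMod 2)) :
    Submodule (ZMod 2) (Fin (n + n) → ZMod 2) where
  carrier := {v | Matrix.vecMul (fstHalf v) M = sndHalf v}
  zero_mem' := Matrix.zero_vecMul M
  add_mem' {v w} hv hw := by
    change Matrix.vecMul (fstHalf v + fstHalf w) M = sndHalf v + sndHalf w
    rw [Matrix.add_vecMul, hv, hw]
  smul_mem' a v hv := by
    change Matrix.vecMul (a • fstHalf v) M = a • sndHalf v
    rw [Matrix.smul_vecMul, hv]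

theorem mem_doubleCode {n : ℕ} {M : Matrix (Fin n) (Fin n) (ZMod 2)}
    {v : Fin (n + n) → ZMod 2} : v ∈ doubleCode M ↔ Matrix.vecMul (fstHalf v) M = sndHalf v :=
  Iff.rfl

theorem isSelfDual_doubleCode {n : ℕ} {M : Matrix (Fin n) (Fin n) (ZMod 2)}
    (hM : M * M.transpose = 1) : IsSelfDual (doubleCode M) := by
  have hM' : M.transpose * M = 1 := mul_eq_one_comm.1 hM
  have hsum (x y : Fin (n + n) → ZMod 2) :
      ∑ i, x i * y i = fstHalf x ⬝ᵥ fstHalf y + sndHalf x ⬝ᵥ sndHalf y :=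
    Fin.sum_univ_add _
  intro x
  refine ⟨fun hx y hy => ?_, fun h => ?_⟩
  · rw [mem_doubleCode] at hx hy
    rw [hsum, ← hx, ← hy, ← Matrix.dotProduct_mulVec, ← Matrix.mulVec_transpose,
      Matrix.mulVec_mulVec, hM, Matrix.one_mulVec, CharTwo.add_self_eq_zero]
  · have h₁ : fstHalf x = M.mulVec (sndHalf x) := by
      refine dotProduct_eq _ _ fun e => ?_
      have he := h (Fin.append e (Matrix.vecMul e M)) (by simp [mem_doubleCode])
      rw [hsum, fstHalf_append, sndHalf_append, CharTwo.add_eq_zero] at he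
      rw [he, dotProduct_comm, ← Matrix.dotProduct_mulVec, dotProduct_comm]
    rw [mem_doubleCode, h₁, ← Matrix.mulVec_transpose, Matrix.mulVec_mulVec, hM',
      Matrix.one_mulVec]

theorem hamWt_eq_add {n : ℕ} (v : Fin (n + n) → ZMod 2) :
    hamWt v = hamWt (fstHalf v) + hamWt (sndHalf v) := by
  simp only [hamWt, Finset.card_filter]
  exact Fin.sum_univ_add _

theorem eq_zero_of_hamWt {ι : Type*} [Fintype ι] {v : ι → ZMod 2} (h : hamWt v = 0) : v = 0 := by
  funext i
  simpa using Finset.filter_eq_empty_iff.1 (Finset.card_eq_zero.1 h) (Finset.mem_univ i)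

theorem weightPairCount_transpose {n : ℕ} {M : Matrix (Fin n) (Fin n) (ZMod 2)}
    (hM : M * M.transpose = 1) (w s : ℕ) :
    weightPairCount M w s = weightPairCount M.transpose s w := by
  have hM' : M.transpose * M = 1 := mul_eq_one_comm.1 hM
  have h₁ (x : Fin n → ZMod 2) : Matrix.vecMul (Matrix.vecMul x M) M.transpose = x := by
    rw [Matrix.vecMul_vecMul, hM, Matrix.vecMul_one]
  have h₂ (x : Fin n → ZMod 2) : Matrix.vecMul (Matrix.vecMul x M.transpose) M = x := by
    rw [Matrix.vecMul_vecMul, hM', Matrix.vecMul_one]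
  refine Finset.card_bij' (fun x _ => Matrix.vecMul x M) (fun x _ => Matrix.vecMul x M.transpose)
    (fun x hx => ?_) (fun x hx => ?_) (fun x _ => h₁ x) (fun x _ => h₂ x)
  · simpa [h₁, and_comm] using hx
  · simpa [h₂, and_comm] using hx

theorem card_doubleCode_hamWt {n : ℕ} (M : Matrix (Fin n) (Fin n) (ZMod 2)) (t : ℕ) :
    Nat.card {v : Fin (n + n) → ZMod 2 // v ∈ doubleCode M ∧ hamWt v = t} =
      ∑ p ∈ Finset.HasAntidiagonal.antidiagonal t, weightPairCount M p.1 p.2 := by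
  classical
  let e : {v : Fin (n + n) → ZMod 2 // v ∈ doubleCode M ∧ hamWt v = t} ≃
      {x : Fin n → ZMod 2 // hamWt x + hamWt (Matrix.vecMul x M) = t} :=
    { toFun v := ⟨fstHalf v.1, by rw [v.2.1, ← hamWt_eq_add, v.2.2]⟩
      invFun x := ⟨Fin.append x.1 (Matrix.vecMul x.1 M), by
        simpa [mem_doubleCode, hamWt_eq_add] using x.2⟩
      left_inv v := by
        refine Subtype.ext ((congrArg (Fin.append (fstHalf v.1)) (mem_doubleCode.1 v.2.1)).trans ?_)
        exact Fin.append_castAdd_natAdd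
      right_inv x := Subtype.ext (fstHalf_append _ _) }
  rw [Nat.card_congr e, Nat.card_eq_fintype_card, Fintype.card_subtype,
    Finset.card_eq_sum_card_fiberwise (t := Finset.HasAntidiagonal.antidiagonal t)
      (f := fun x => (hamWt x, hamWt (Matrix.vecMul x M)))]
  · refine Finset.sum_congr rfl fun p hp => ?_
    rw [weightPairCount, Finset.filter_filter]
    congr 1
    refine Finset.filter_congr fun x _ => ?_
    rw [Finset.HasAntidiagonal.mem_antidiagonal] at hp
    rw [Prod.ext_iff]
    exact ⟨fun h => h.2, fun h => ⟨by rw [h.1, h.2, hp], h⟩⟩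
  · intro x hx
    simpa using hx

theorem bit_dotProduct {n k : ℕ} (h : n ≤ 2 ^ k) (u v : Fin n → ZMod 2) :
    bit (u ⬝ᵥ v) = Nat.testBit (popCount k (Nat.land
      (pack ((List.finRange n).map fun j => bit (u j)))
      (pack ((List.finRange n).map fun j => bit (v j))))) 0 := by
  rw [pack_and, popCount_pack _ _ _ (by simpa using h), dotProduct, ← List.sum_ofFn,
    List.ofFn_eq_map]
  clear h
  induction List.finRange n with
  | nil => simp [bit]
  | cons j js ih =>
    rw [List.map_cons, List.sum_cons, bit_add, bit_mul, ih, List.countP_cons]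
    cases bit (u j) <;> cases bit (v j) <;> simp [Nat.testBit_zero]
    lia

/-- The entries of the four-circulant matrix `[A, B; Bᵀ, Aᵀ]`, where the first rows of the
circulant matrices `A` and `B` of size `18` are the binary digits of `202416` and `19575`. -/
def circ (i j : Fin 36) : Bool :=
  Nat.testBit (if decide (i.val < 18) = decide (j.val < 18) then 202416 else 19575)
    ((if i.val < 18 then j.val + 36 - i.val else i.val + 36 - j.val) % 18)

/-- The four-circulant matrix with entries `circ`. -/
def circMatrix : Matrix (Fin 36) (Fin 36) (ZMod 2) := .of fun i j => bif circ i j then 1 else 0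

theorem bit_circMatrix (i j : Fin 36) : bit (circMatrix i j) = circ i j := by
  rw [circMatrix, Matrix.of_apply]
  cases circ i j <;> rfl

theorem circMatrix_mul_transpose : circMatrix * circMatrix.transpose = 1 := by
  ext i j
  apply bit_injective
  rw [Matrix.mul_apply']
  have h := bit_dotProduct (k := 6) (by norm_num) (circMatrix.row i) (circMatrix.row j)
  simp only [Matrix.row_apply, bit_circMatrix] at h
  refine h.trans ?_
  have : ∀ i j : Fin 36, Nat.testBit (popCount 6 (Nat.land
      (pack ((List.finRange 36).map fun k => circ i k))
      (pack ((List.finRange 36).map fun k => circ j k)))) 0 = decide (i = j) := by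
    decide +kernel
  rw [this, Matrix.one_apply]
  split_ifs with h <;> simp [h, bit]

/-- The weights whose frequencies among the sums of `0, 1, …, 7` rows of `circMatrix` are needed. -/
def targets : List (List ℕ) :=
  [List.range 15, List.range 14, List.range 13, List.range 12, List.range 11, List.range 10,
    [6, 8], [7]]

/-- The frequencies of the weights `targets`. -/
def counts : List (List ℕ) :=
  [[1, 0, 0, 0, 0, 0, 0, 0, 0, 0, 0, 0, 0, 0, 0], [0, 0, 0, 0, 0, 0, 0, 0, 0, 0, 0, 0, 0, 0],
    [0, 0, 0, 0, 0, 0, 0, 0, 0, 0, 18, 0, 0], [0, 0, 0, 0, 0, 0, 0, 0, 0, 0, 0, 324],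
    [0, 0, 0, 0, 0, 0, 0, 0, 54, 0, 0], [0, 0, 0, 0, 0, 0, 0, 0, 0, 1944], [204, 0], [4176]]

/-- The weights whose frequencies among the sums of `0, 1, …, 6` columns of `circMatrix` are
needed. -/
def colTargets : List (List ℕ) :=
  [List.range 15, List.range 14, List.range 13, List.range 12, List.range 11, List.range 10, [8]]

/-- The frequencies of the weights `colTargets`. -/
def colCounts : List (List ℕ) :=
  [[1, 0, 0, 0, 0, 0, 0, 0, 0, 0, 0, 0, 0, 0, 0], [0, 0, 0, 0, 0, 0, 0, 0, 0, 0, 0, 0, 0, 0],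
    [0, 0, 0, 0, 0, 0, 0, 0, 0, 0, 0, 0, 0], [0, 0, 0, 0, 0, 0, 0, 0, 0, 0, 0, 288],
    [0, 0, 0, 0, 0, 0, 0, 0, 108, 0, 0], [0, 0, 0, 0, 0, 0, 0, 0, 0, 1908], [0]]

theorem weightCounts_circ :
    List.zipWith (PackedWords.weightCounts 23)
      (rowSums 36 7 ((List.finRange 36).map fun i => (List.finRange 36).map fun j => circ i j))
      targets = counts := by
  decide +kernel

theorem weightCounts_circ_transpose :
    List.zipWith (PackedWords.weightCounts 21)
      (rowSums 36 6 ((List.finRange 36).map fun i => (List.finRange 36).map fun j => circ j i))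
      colTargets = colCounts := by
  decide +kernel

theorem weightPairCount_circMatrix :
    List.zipWith (fun w => List.map (weightPairCount circMatrix w)) (List.range 8) targets =
      counts :=
  (zipWith_weightCounts circMatrix bit_circMatrix
    (fun w hw => by interval_cases w <;> norm_num [Nat.choose]) _).trans weightCounts_circ

theorem weightPairCount_circMatrix_transpose :
    List.zipWith (fun w => List.map (weightPairCount circMatrix.transpose w)) (List.range 7)
      colTargets = colCounts :=
  (zipWith_weightCounts circMatrix.transpose (fun i j => bit_circMatrix j i)
    (fun w hw => by interval_cases w <;> norm_num [Nat.choose]) _).trans weightCounts_circ_transpose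

theorem sum_antidiagonal_of_counts {N N' : ℕ → ℕ → ℕ} (h : ∀ w s, N w s = N' s w)
    (hN : List.zipWith (fun w => List.map (N w)) (List.range 8) targets = counts)
    (hN' : List.zipWith (fun w => List.map (N' w)) (List.range 7) colTargets = colCounts) :
    (∀ t, 0 < t → t < 12 → ∑ p ∈ Finset.HasAntidiagonal.antidiagonal t, N p.1 p.2 = 0) ∧
      ∑ p ∈ Finset.HasAntidiagonal.antidiagonal 12, N p.1 p.2 = 384 ∧
      ∑ p ∈ Finset.HasAntidiagonal.antidiagonal 14, N p.1 p.2 = 8640 := by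
  simp only [targets, counts, colTargets, colCounts, List.range_eq_range', List.range'_succ,
    List.range'_zero, List.zipWith_cons_cons, List.zipWith_nil_left, List.map_cons, List.map_nil,
    List.cons.injEq, and_true, Nat.reduceAdd, ← h] at hN hN'
  simp only [Finset.Nat.sum_antidiagonal_eq_sum_range_succ_mk]
  refine ⟨fun t h0 ht => ?_, ?_, ?_⟩
  · interval_cases t <;> simp [Finset.sum_range_succ, hN, hN']
  · simp [Finset.sum_range_succ, hN, hN']
  · simp [Finset.sum_range_succ, hN, hN']

end PackedCount

open PackedCount in
/-- There is a self-dual binary linear code of length 72 with minimum nonzero Hamming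
weight 12, having exactly 384 codewords of weight 12 and exactly 8640 codewords of
weight 14 (weight enumerator `W_{72,1}` with γ = 0 and β = 192). -/
theorem exists_selfDual_code_72_gamma_0_beta_192 :
    ∃ C : Submodule (ZMod 2) (Fin 72 → ZMod 2),
      IsSelfDual C ∧
      IsLeast {k | ∃ v ∈ C, v ≠ 0 ∧ hamWt v = k} 12 ∧
      Nat.card {v : Fin 72 → ZMod 2 // v ∈ C ∧ hamWt v = 12} = 384 ∧
      Nat.card {v : Fin 72 → ZMod 2 // v ∈ C ∧ hamWt v = 14} = 8640 := by
  obtain ⟨h, h₁₂, h₁₄⟩ := sum_antidiagonal_of_counts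
    (weightPairCount_transpose circMatrix_mul_transpose) weightPairCount_circMatrix
    weightPairCount_circMatrix_transpose
  have hcard : Nat.card {v : Fin (36 + 36) → ZMod 2 // v ∈ doubleCode circMatrix ∧ hamWt v = 12} =
      384 := (card_doubleCode_hamWt _ _).trans h₁₂
  refine ⟨doubleCode circMatrix, isSelfDual_doubleCode circMatrix_mul_transpose, ⟨?_, ?_⟩,
    hcard, (card_doubleCode_hamWt _ _).trans h₁₄⟩
  · obtain ⟨⟨v, hv, hw⟩⟩ := (Nat.card_pos_iff.1 (by rw [hcard]; norm_num)).1
    refine ⟨v, hv, ?_, hw⟩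
    rintro rfl
    simp [hamWt] at hw
  · rintro t ⟨v, hv, hv0, hw⟩
    by_contra! ht
    have h0 : 0 < t := by
      rw [← hw]
      exact Nat.pos_of_ne_zero fun h => hv0 (eq_zero_of_hamWt h)
    have hc := (card_doubleCode_hamWt circMatrix t).trans (h t h0 ht)
    rw [Finite.card_eq_zero_iff] at hc
    exact hc.false ⟨v, hv, hw⟩
end
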